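/- Let H ≥ 1 be an integer, α ∈ [0,1], and H_α := Σ_{t=0}^{H−1} α^{2t}. Define the H×H real matrix C by C(i,j) = H_α^{−1} Σ_{t=max(i,j)}^{H} α^{2t−i−j}. Then C is symmetric positive definite and xᵀ C x ≥ ‖x‖₂² / (4 H_α) for every x ∈ ℝ^H; equivalently, the smallest eigenvalue of C is at least 1/(4 H_α). -/

import Mathlib

open Finset Matrix

/-- Effective history horizon `H_α = ∑_{t=0}^{H-1} α^{2t}`. -/
noncomputable def effHorizon (H : ℕ) (α : ℝ) : ℝ := ∑ t ∈ Finset.range H, α ^ (2 * t)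

/-- The dense block of the Gram matrix of the truncated discounted vectors:
`C(i,j) = H_α⁻¹ ∑_{t=max(i,j)}^{H} α^(2t-i-j)` for `i, j ∈ {1, …, H}`
(here `i j : Fin H` are `0`-indexed, so `i` stands for `i+1`). -/
noncomputable def gramBlock (H : ℕ) (α : ℝ) : Matrix (Fin H) (Fin H) ℝ := fun i j =>
  (effHorizon H α)⁻¹ *
    ∑ t ∈ Finset.Icc (max ((i : ℕ) + 1) ((j : ℕ) + 1)) H, α ^ (2 * t - ((i : ℕ) + 1) - ((j : ℕ) + 1))

/-- The lower triangular matrix of discounted powers, `α ^ (k - i)` for `i ≤ k`. -/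
noncomputable def discountFactor (H : ℕ) (α : ℝ) : Matrix (Fin H) (Fin H) ℝ := fun k i =>
  if i ≤ k then α ^ ((k : ℕ) - (i : ℕ)) else 0

theorem gramBlock_eq_smul_transpose_mul (H : ℕ) (α : ℝ) :
    gramBlock H α = (effHorizon H α)⁻¹ • ((discountFactor H α)ᵀ * discountFactor H α) := by
  ext i j
  simp only [gramBlock, Matrix.smul_apply, Matrix.mul_apply, Matrix.transpose_apply, smul_eq_mul,
    discountFactor]
  congr 1
  have hterm : ∀ k : Fin H,
      ((if i ≤ k then α ^ ((k : ℕ) - (i : ℕ)) else 0) *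
        if j ≤ k then α ^ ((k : ℕ) - (j : ℕ)) else 0) =
      (fun n : ℕ => if max (i : ℕ) j ≤ n then α ^ (2 * (n + 1) - ((i : ℕ) + 1) - ((j : ℕ) + 1))
        else 0) k := by
    intro k
    by_cases hi : (i : ℕ) ≤ k <;> by_cases hj : (j : ℕ) ≤ k <;>
      simp only [Fin.le_def, hi, hj, max_le_iff, and_self, and_true, true_and, if_true, if_false,
        mul_zero, zero_mul]
    rw [← pow_add]
    congr 1
    omega
  rw [Finset.sum_congr rfl fun k _ => hterm k,
    Fin.sum_univ_eq_sum_range (fun n : ℕ => if max (i : ℕ) j ≤ n then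
      α ^ (2 * (n + 1) - ((i : ℕ) + 1) - ((j : ℕ) + 1)) else 0) H, ← Finset.sum_filter]
  refine Finset.sum_nbij' (fun t => t - 1) (fun n => n + 1) ?_ ?_ ?_ ?_ ?_
  · intro t ht
    simp only [Finset.mem_Icc, Finset.mem_filter, Finset.mem_range] at ht ⊢
    omega
  · intro n hn
    simp only [Finset.mem_Icc, Finset.mem_filter, Finset.mem_range] at hn ⊢
    omega
  · intro t ht
    simp only [Finset.mem_Icc] at ht
    omega
  · intro n _
    rfl
  · intro t ht
    simp only [Finset.mem_Icc] at ht
    have : t - 1 + 1 = t := by omega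
    rw [this]

theorem sum_sq_le_four_mul_sum_sq_of_recurrence {α : ℝ} (hα : α ∈ Set.Icc (0 : ℝ) 1)
    {y s : ℕ → ℝ} (h0 : s 0 = y 0) (hs : ∀ n, s (n + 1) = α * s n + y (n + 1)) (N : ℕ) :
    ∑ n ∈ Finset.range N, y n ^ 2 ≤ 4 * ∑ n ∈ Finset.range N, s n ^ 2 := by
  have key : ∀ n, ∑ m ∈ Finset.range (n + 1), y m ^ 2 + 2 * s n ^ 2 ≤
      4 * ∑ m ∈ Finset.range (n + 1), s m ^ 2 := by
    intro n
    induction n with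
    | zero =>
      simp only [zero_add, Finset.sum_range_one, ← h0]
      nlinarith [sq_nonneg (s 0)]
    | succ n ih =>
      rw [Finset.sum_range_succ, Finset.sum_range_succ (fun m => s m ^ 2)]
      have hy : y (n + 1) = s (n + 1) - α * s n := by rw [hs]; ring
      have hle : (α * s n) ^ 2 ≤ s n ^ 2 := by
        rw [mul_pow]
        exact mul_le_of_le_one_left (sq_nonneg _) (pow_le_one₀ hα.1 hα.2)
      rw [hy]
      nlinarith [sq_nonneg (s (n + 1) + α * s n)]
  cases N with
  | zero => simp
  | succ n => nlinarith [key n, sq_nonneg (s n)]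

theorem sum_sq_le_four_mul_discountFactor_mulVec {H : ℕ} {α : ℝ} (hα : α ∈ Set.Icc (0 : ℝ) 1)
    (x : Fin H → ℝ) :
    ∑ i, x i ^ 2 ≤ 4 * ∑ k, (discountFactor H α *ᵥ x) k ^ 2 := by
  set y : ℕ → ℝ := fun n => if h : n < H then x ⟨n, h⟩ else 0 with hy
  set s : ℕ → ℝ := fun n => ∑ i ∈ Finset.range (n + 1), α ^ (n - i) * y i with hs
  have hyx : ∀ i : Fin H, x i = y i := fun i => by simp [hy]
  have hBs : ∀ k : Fin H, (discountFactor H α *ᵥ x) k = s k := by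
    intro k
    simp only [Matrix.mulVec, dotProduct, discountFactor, hyx, Fin.le_def]
    rw [Fin.sum_univ_eq_sum_range
      (fun i : ℕ => (if i ≤ (k : ℕ) then α ^ ((k : ℕ) - i) else 0) * y i) H]
    simp only [ite_mul, zero_mul, ← Finset.sum_filter, hs]
    refine Finset.sum_congr ?_ fun _ _ => rfl
    ext i
    simp only [Finset.mem_filter, Finset.mem_range]
    omega
  have hrec : ∀ n, s (n + 1) = α * s n + y (n + 1) := by
    intro n
    simp only [hs]
    rw [Finset.sum_range_succ, Finset.mul_sum, Nat.sub_self, pow_zero, one_mul]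
    congr 1
    refine Finset.sum_congr rfl fun i hi => ?_
    rw [Nat.succ_sub (Finset.mem_range_succ_iff.mp hi), pow_succ']
    ring
  simp only [hBs, hyx]
  rw [Fin.sum_univ_eq_sum_range (fun n => y n ^ 2) H,
    Fin.sum_univ_eq_sum_range (fun n => s n ^ 2) H]
  exact sum_sq_le_four_mul_sum_sq_of_recurrence hα (by simp [hs]) hrec H

theorem effHorizon_pos {H : ℕ} (hH : 1 ≤ H) {α : ℝ} (hα : 0 ≤ α) : 0 < effHorizon H α := by
  refine Finset.sum_pos' (fun t _ => pow_nonneg hα _) ⟨0, Finset.mem_range.mpr hH, ?_⟩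
  simp

theorem dotProduct_gramBlock_mulVec (H : ℕ) (α : ℝ) (x : Fin H → ℝ) :
    x ⬝ᵥ (gramBlock H α *ᵥ x) =
      (effHorizon H α)⁻¹ * ∑ k, (discountFactor H α *ᵥ x) k ^ 2 := by
  rw [gramBlock_eq_smul_transpose_mul, Matrix.smul_mulVec, dotProduct_smul, smul_eq_mul,
    ← Matrix.mulVec_mulVec, Matrix.dotProduct_mulVec, Matrix.vecMul_transpose]
  simp only [dotProduct, sq]

/-- The Gram-block matrix `C` is symmetric positive definite and its smallest eigenvalue is at
least `1/(4 H_α)`: `xᵀ C x ≥ ‖x‖² / (4 H_α)` for every `x ∈ ℝ^H`. -/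
theorem gramBlock_posDef_quadratic_lower_bound (H : ℕ) (hH : 1 ≤ H)
    (α : ℝ) (hα : α ∈ Set.Icc (0 : ℝ) 1) :
    (gramBlock H α).PosDef ∧
    ∀ x : Fin H → ℝ, (∑ i, x i ^ 2) / (4 * effHorizon H α) ≤ x ⬝ᵥ (gramBlock H α *ᵥ x) := by
  have hpos := effHorizon_pos hH hα.1
  have hbound : ∀ x : Fin H → ℝ,
      (∑ i, x i ^ 2) / (4 * effHorizon H α) ≤ x ⬝ᵥ (gramBlock H α *ᵥ x) := by
    intro x
    rw [dotProduct_gramBlock_mulVec, div_le_iff₀ (by positivity)]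
    refine (sum_sq_le_four_mul_discountFactor_mulVec hα x).trans_eq ?_
    field_simp
  refine ⟨Matrix.PosDef.of_dotProduct_mulVec_pos ?_ fun x hx => ?_, hbound⟩
  · rw [gramBlock_eq_smul_transpose_mul, Matrix.IsHermitian,
      Matrix.conjTranspose_eq_transpose_of_trivial]
    simp
  · obtain ⟨i, hi⟩ := Function.ne_iff.mp hx
    have hsum : 0 < ∑ i, x i ^ 2 :=
      Finset.sum_pos' (fun _ _ => sq_nonneg _) ⟨i, Finset.mem_univ i, sq_pos_of_ne_zero hi⟩
    rw [star_trivial]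
    exact (div_pos hsum (by positivity)).trans_le (hbound x)
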